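/- arXiv:2010.00448 — 4 statements merged into one kernel-verified Lean document; each statement's English description precedes it below -/
import Mathlib

section
/- Let f be continuous on clos ℂ₊, analytic in ℂ₊, and operator Lipschitz on clos ℂ₊ (f ∈ OL_A(ℂ₊)). Then for every ε > 0 the function f_ε(z) = (1 − iεz)^{-1} f(z) is also continuous on clos ℂ₊, analytic in ℂ₊, and operator Lipschitz on clos ℂ₊; that is, there exists C' ≥ 0 such that ‖f_ε(N₁) − f_ε(N₂)‖ ≤ C'‖N₁ − N₂‖ for all bounded normal operators N₁, N₂ with spectra contained in clos ℂ₊. -/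
/-- `f` is operator Lipschitz on the closed upper half-plane with constant `C`:
`‖f(N₁) − f(N₂)‖ ≤ C‖N₁ − N₂‖` for all bounded normal operators `N₁`, `N₂` on a complex
Hilbert space whose spectra are contained in `{z : Im z ≥ 0}` (`f(N)` is given by the
continuous functional calculus). -/
def OpLipschitzUHP (f : ℂ → ℂ) (C : ℝ) : Prop :=
  ∀ (K : Type) [NormedAddCommGroup K] [InnerProductSpace ℂ K] [CompleteSpace K],
    ∀ N₁ N₂ : K →L[ℂ] K, IsStarNormal N₁ → IsStarNormal N₂ →
      spectrum ℂ N₁ ⊆ {z : ℂ | 0 ≤ z.im} → spectrum ℂ N₂ ⊆ {z : ℂ | 0 ≤ z.im} →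
      ‖cfc f N₁ - cfc f N₂‖ ≤ C * ‖N₁ - N₂‖

lemma one_le_norm_one_sub_I_mul {ε : ℝ} (hε : 0 < ε) {z : ℂ} (hz : 0 ≤ z.im) :
    1 ≤ ‖1 - Complex.I * (ε : ℂ) * z‖ := by
  have h := Complex.re_le_norm (1 - Complex.I * (ε : ℂ) * z)
  simp at h
  nlinarith [mul_nonneg hε.le hz]

lemma mul_norm_le_norm_one_sub_I_mul {ε : ℝ} (hε : 0 < ε) {z : ℂ} (hz : 0 ≤ z.im) :
    ε * ‖z‖ ≤ ‖1 - Complex.I * (ε : ℂ) * z‖ := by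
  refine (sq_le_sq₀ (by positivity) (norm_nonneg _)).mp ?_
  rw [mul_pow, ← Complex.normSq_eq_norm_sq, ← Complex.normSq_eq_norm_sq, Complex.normSq_apply,
    Complex.normSq_apply]
  simp
  nlinarith [mul_nonneg hε.le hz]

lemma one_sub_I_mul_ne_zero {ε : ℝ} (hε : 0 < ε) {z : ℂ} (hz : 0 ≤ z.im) :
    1 - Complex.I * (ε : ℂ) * z ≠ 0 :=
  norm_pos_iff.mp (zero_lt_one.trans_le (one_le_norm_one_sub_I_mul hε hz))

lemma continuousOn_inv_one_sub_I_mul {ε : ℝ} (hε : 0 < ε) :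
    ContinuousOn (fun z : ℂ => (1 - Complex.I * (ε : ℂ) * z)⁻¹) {z : ℂ | 0 ≤ z.im} :=
  ContinuousOn.inv₀ (by fun_prop) fun _ hz => one_sub_I_mul_ne_zero hε hz

/-- An operator Lipschitz function is Lipschitz, as one sees from scalar operators. -/
lemma OpLipschitzUHP.norm_sub_le {f : ℂ → ℂ} {C : ℝ} (h : OpLipschitzUHP f C) {z w : ℂ}
    (hz : 0 ≤ z.im) (hw : 0 ≤ w.im) : ‖f z - f w‖ ≤ C * ‖z - w‖ := by
  have normal (a : ℂ) : IsStarNormal (algebraMap ℂ (ℂ →L[ℂ] ℂ) a) :=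
    ⟨Algebra.commutes a _ |>.symm⟩
  have key := h ℂ (algebraMap ℂ (ℂ →L[ℂ] ℂ) z) (algebraMap ℂ (ℂ →L[ℂ] ℂ) w)
    (normal z) (normal w)
    (by rw [spectrum.scalar_eq]; simpa using hz) (by rw [spectrum.scalar_eq]; simpa using hw)
  rwa [cfc_algebraMap, cfc_algebraMap, ← map_sub, ← map_sub, norm_algebraMap', norm_algebraMap']
    at key

lemma OpLipschitzUHP.norm_inv_mul_le {f : ℂ → ℂ} {C : ℝ} (h : OpLipschitzUHP f C) (hC : 0 ≤ C)
    {ε : ℝ} (hε : 0 < ε) {z : ℂ} (hz : 0 ≤ z.im) :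
    ‖(1 - Complex.I * (ε : ℂ) * z)⁻¹ * f z‖ ≤ ‖f 0‖ + C / ε := by
  have h1 := one_le_norm_one_sub_I_mul hε hz
  have h2 := mul_norm_le_norm_one_sub_I_mul hε hz
  have h3 : ‖f z‖ ≤ ‖f 0‖ + C * ‖z‖ := by
    have h4 := h.norm_sub_le hz (w := 0) (by simp)
    rw [sub_zero] at h4
    linarith [norm_sub_norm_le (f z) (f 0)]
  rw [norm_mul, norm_inv, inv_mul_le_iff₀ (by linarith)]
  calc ‖f z‖ ≤ 1 * ‖f 0‖ + C / ε * (ε * ‖z‖) := by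
        rw [one_mul, ← mul_assoc, div_mul_cancel₀ _ hε.ne']; exact h3
    _ ≤ ‖1 - Complex.I * (ε : ℂ) * z‖ * ‖f 0‖ + C / ε * ‖1 - Complex.I * (ε : ℂ) * z‖ := by gcongr
    _ = _ := by ring

section Resolvent

variable {K : Type} [NormedAddCommGroup K] [InnerProductSpace ℂ K] [CompleteSpace K]
  {N : K →L[ℂ] K} {ε : ℝ}

lemma norm_cfc_inv_one_sub_I_mul_le (hε : 0 < ε) (hs : spectrum ℂ N ⊆ {z : ℂ | 0 ≤ z.im}) :
    ‖cfc (fun z : ℂ => (1 - Complex.I * (ε : ℂ) * z)⁻¹) N‖ ≤ 1 :=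
  norm_cfc_le zero_le_one fun z hz => by
    rw [norm_inv]
    exact inv_le_one_of_one_le₀ (one_le_norm_one_sub_I_mul hε (hs hz))

lemma cfc_one_sub_I_mul (hN : IsStarNormal N) :
    cfc (fun z : ℂ => 1 - Complex.I * (ε : ℂ) * z) N = 1 - (Complex.I * (ε : ℂ)) • N := by
  rw [cfc_sub (fun _ : ℂ => (1 : ℂ)) (fun z : ℂ => Complex.I * (ε : ℂ) * z) N, cfc_const_one ℂ N,
    cfc_const_mul_id _ N]

lemma cfc_inv_mul_one_sub (hε : 0 < ε) (hN : IsStarNormal N)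
    (hs : spectrum ℂ N ⊆ {z : ℂ | 0 ≤ z.im}) :
    cfc (fun z : ℂ => (1 - Complex.I * (ε : ℂ) * z)⁻¹) N * (1 - (Complex.I * (ε : ℂ)) • N) = 1 := by
  rw [← cfc_one_sub_I_mul hN, ← cfc_mul _ _ N ((continuousOn_inv_one_sub_I_mul hε).mono hs),
    ← cfc_const_one ℂ N]
  exact cfc_congr fun z hz => inv_mul_cancel₀ (one_sub_I_mul_ne_zero hε (hs hz))

lemma one_sub_mul_cfc_inv (hε : 0 < ε) (hN : IsStarNormal N)
    (hs : spectrum ℂ N ⊆ {z : ℂ | 0 ≤ z.im}) :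
    (1 - (Complex.I * (ε : ℂ)) • N) * cfc (fun z : ℂ => (1 - Complex.I * (ε : ℂ) * z)⁻¹) N = 1 := by
  rw [← cfc_one_sub_I_mul hN, (cfc_commute_cfc _ _ N).eq, cfc_one_sub_I_mul hN,
    cfc_inv_mul_one_sub hε hN hs]

end Resolvent

/-- If `f` is continuous on the closed upper half-plane, analytic in the open upper
half-plane and operator Lipschitz there (`f ∈ OL_A(ℂ₊)`), then for every `ε > 0` the
function `f_ε(z) = (1 − iεz)⁻¹ f(z)` has the same properties; in particular there is a
constant `C' ≥ 0` with `‖f_ε(N₁) − f_ε(N₂)‖ ≤ C'‖N₁ − N₂‖` for all bounded normal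
operators `N₁, N₂` with spectra in the closed upper half-plane. -/
theorem opLipschitz_of_mul_resolvent_factor (f : ℂ → ℂ)
    (hc : ContinuousOn f {z : ℂ | 0 ≤ z.im})
    (ha : DifferentiableOn ℂ f {z : ℂ | 0 < z.im})
    (C : ℝ) (hC : 0 ≤ C) (hlip : OpLipschitzUHP f C)
    (ε : ℝ) (hε : 0 < ε) :
    ContinuousOn (fun z : ℂ => (1 - Complex.I * (ε : ℂ) * z)⁻¹ * f z) {z : ℂ | 0 ≤ z.im} ∧
    DifferentiableOn ℂ (fun z : ℂ => (1 - Complex.I * (ε : ℂ) * z)⁻¹ * f z)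
      {z : ℂ | 0 < z.im} ∧
    ∃ C' : ℝ, 0 ≤ C' ∧ OpLipschitzUHP (fun z : ℂ => (1 - Complex.I * (ε : ℂ) * z)⁻¹ * f z) C' := by
  have hr := continuousOn_inv_one_sub_I_mul hε
  refine ⟨hr.mul hc, ?_, C + (‖f 0‖ + C / ε) * ε, by positivity, ?_⟩
  · exact DifferentiableOn.mul (DifferentiableOn.inv (by fun_prop)
      fun z hz => one_sub_I_mul_ne_zero hε (le_of_lt hz)) ha
  intro K _ _ _ N₁ N₂ hN₁ hN₂ hs₁ hs₂
  have hg : ‖cfc (fun z : ℂ => (1 - Complex.I * (ε : ℂ) * z)⁻¹ * f z) N₁‖ ≤ ‖f 0‖ + C / ε :=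
    norm_cfc_le (by positivity) fun z hz => hlip.norm_inv_mul_le hC hε (hs₁ hz)
  have hR := norm_cfc_inv_one_sub_I_mul_le hε hs₂
  have hcancel₁ := cfc_inv_mul_one_sub hε hN₁ hs₁
  have hcancel₂ := one_sub_mul_cfc_inv hε hN₂ hs₂
  have hF := hlip K N₁ N₂ hN₁ hN₂ hs₁ hs₂
  have hmul₁ := cfc_mul _ f N₁ (hr.mono hs₁) (hc.mono hs₁)
  have hcomm₁ := (cfc_commute_cfc (fun z : ℂ => (1 - Complex.I * (ε : ℂ) * z)⁻¹) f N₁).eq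
  have hmul₂ := cfc_mul _ f N₂ (hr.mono hs₂) (hc.mono hs₂)
  have hcomm₂ := (cfc_commute_cfc (fun z : ℂ => (1 - Complex.I * (ε : ℂ) * z)⁻¹) f N₂).eq
  set G₁ := cfc (fun z : ℂ => (1 - Complex.I * (ε : ℂ) * z)⁻¹ * f z) N₁
  set G₂ := cfc (fun z : ℂ => (1 - Complex.I * (ε : ℂ) * z)⁻¹ * f z) N₂
  set R₁ := cfc (fun z : ℂ => (1 - Complex.I * (ε : ℂ) * z)⁻¹) N₁
  set R₂ := cfc (fun z : ℂ => (1 - Complex.I * (ε : ℂ) * z)⁻¹) N₂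
  have hres : R₁ - R₂ = R₁ * ((Complex.I * (ε : ℂ)) • (N₁ - N₂)) * R₂ := by
    calc R₁ - R₂ = R₁ * ((1 - (Complex.I * (ε : ℂ)) • N₂) * R₂)
          - (R₁ * (1 - (Complex.I * (ε : ℂ)) • N₁)) * R₂ := by
          rw [hcancel₁, hcancel₂, mul_one, one_mul]
      _ = _ := by rw [smul_sub]; noncomm_ring
  have hdecomp : G₁ - G₂ = (cfc f N₁ - cfc f N₂) * R₂
      + G₁ * ((Complex.I * (ε : ℂ)) • (N₁ - N₂)) * R₂ := by
    calc G₁ - G₂ = (cfc f N₁ - cfc f N₂) * R₂ + cfc f N₁ * (R₁ - R₂) := by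
          rw [hmul₁, hmul₂, hcomm₁, hcomm₂]; noncomm_ring
      _ = _ := by rw [hres, hmul₁, hcomm₁]; noncomm_ring
  have hsmul : ‖(Complex.I * (ε : ℂ)) • (N₁ - N₂)‖ = ε * ‖N₁ - N₂‖ := by
    rw [norm_smul, norm_mul, Complex.norm_I, one_mul, Complex.norm_real, Real.norm_of_nonneg hε.le]
  calc ‖G₁ - G₂‖ ≤ ‖cfc f N₁ - cfc f N₂‖ * ‖R₂‖
        + ‖G₁‖ * ‖(Complex.I * (ε : ℂ)) • (N₁ - N₂)‖ * ‖R₂‖ := by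
        rw [hdecomp]
        exact (norm_add_le _ _).trans (add_le_add (norm_mul_le _ _) (norm_mul₃_le))
    _ ≤ (C * ‖N₁ - N₂‖) * 1 + (‖f 0‖ + C / ε) * (ε * ‖N₁ - N₂‖) * 1 := by
        rw [hsmul]
        gcongr
    _ = (C + (‖f 0‖ + C / ε) * ε) * ‖N₁ - N₂‖ := by ring
end

section
/- Let σ > 0 and f ∈ (ℰ_σ^∞)_+. Then for all x, y ∈ ℝ with x ≠ y and σx ∉ 2πℤ, the series ∑_{n∈ℤ} σ · (f(x) − f(2πn/σ))/(σx − 2πn) · (e^{iσy} − 1)/(i(σy − 2πn)) converges absolutely and equals (f(x) − f(y))/(x − y), where for σy = 2πn the factor (e^{iσy} − 1)/(i(σy − 2πn)) is understood as the value 1 of its entire extension. -/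
open MeasureTheory

/-- The class `(ℰ_σ^∞)₊`: entire functions that are bounded on the closed upper half-plane
and such that `e^{-iσz} f(z)` is bounded on the closed lower half-plane (equivalently,
bounded functions on `ℝ` whose Fourier transform is supported in `[0, σ]`). -/
def MemEInftyPlus (σ : ℝ) (f : ℂ → ℂ) : Prop :=
  Differentiable ℂ f ∧
  (∃ C : ℝ, ∀ z : ℂ, 0 ≤ z.im → ‖f z‖ ≤ C) ∧
  (∃ C : ℝ, ∀ z : ℂ, z.im ≤ 0 → ‖Complex.exp (-(Complex.I * (σ : ℂ) * z)) * f z‖ ≤ C)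

/-- The factor `(e^{iσy} − 1)/(i(σy − 2πn))`, understood as the value `1` of its entire
extension when `σy = 2πn`. -/
noncomputable def sincFac (σ : ℝ) (n : ℤ) (y : ℝ) : ℂ :=
  if σ * y = 2 * Real.pi * n then 1
  else (Complex.exp (Complex.I * ((σ * y : ℝ) : ℂ)) - 1) /
    (Complex.I * (((σ * y : ℝ) : ℂ) - ((2 * Real.pi * n : ℝ) : ℂ)))

open Set Filter Topology

/-- The entire function `w ↦ e^{2πiw} − 1`, whose zeros are exactly the integers. -/
noncomputable def expKernel (w : ℂ) : ℂ := Complex.exp (2 * Real.pi * Complex.I * w) - 1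

lemma hasDerivAt_expKernel (w : ℂ) :
    HasDerivAt expKernel
      (Complex.exp (2 * Real.pi * Complex.I * w) * (2 * Real.pi * Complex.I)) w := by
  have h : HasDerivAt (fun w => Complex.exp (2 * Real.pi * Complex.I * w))
      (Complex.exp (2 * Real.pi * Complex.I * w) * (2 * Real.pi * Complex.I)) w := by
    simpa using ((hasDerivAt_id w).const_mul (2 * Real.pi * Complex.I)).cexp
  exact h.sub_const 1

lemma differentiable_expKernel : Differentiable ℂ expKernel :=
  fun w => (hasDerivAt_expKernel w).differentiableAt

lemma expKernel_eq_zero_iff {w : ℂ} : expKernel w = 0 ↔ ∃ n : ℤ, w = n := by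
  have h : (2 * Real.pi * Complex.I : ℂ) ≠ 0 := by simp [Real.pi_ne_zero]
  rw [expKernel, sub_eq_zero, Complex.exp_eq_one_iff]
  refine exists_congr fun n => ?_
  rw [mul_comm, mul_left_inj' h]

lemma expKernel_intCast (n : ℤ) : expKernel n = 0 := expKernel_eq_zero_iff.2 ⟨n, rfl⟩

lemma deriv_expKernel_intCast (n : ℤ) : deriv expKernel n = 2 * Real.pi * Complex.I := by
  rw [(hasDerivAt_expKernel n).deriv, sub_eq_zero.1 (expKernel_intCast n), one_mul]

lemma dslope_expKernel_intCast_of_ne {m n : ℤ} (h : m ≠ n) :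
    dslope expKernel (n : ℂ) (m : ℂ) = 0 := by
  rw [dslope_of_ne _ (by exact_mod_cast h), slope_def_field, expKernel_intCast,
    expKernel_intCast, sub_zero, zero_div]

lemma norm_expKernel_ofReal_le (t : ℝ) : ‖expKernel t‖ ≤ 2 := by
  have h : ‖Complex.exp (2 * Real.pi * Complex.I * t)‖ = 1 := by simp [Complex.norm_exp]
  calc ‖expKernel t‖ ≤ ‖Complex.exp (2 * Real.pi * Complex.I * t)‖ + ‖(1 : ℂ)‖ := norm_sub_le _ _
    _ = 2 := by rw [h, norm_one]; norm_num

/-- On the boundary of the square with half-side `N + 1/2`, the function `e^{2πiw} − 1` is bounded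
below. -/
lemma half_max_le_norm_expKernel {z : ℂ} (N : ℕ)
    (hz : |z.re| = N + 1 / 2 ∨ 1 / 2 ≤ |z.im|) :
    1 / 2 * max 1 (Real.exp (-(2 * Real.pi * z.im))) ≤ ‖expKernel z‖ := by
  have hn : ‖Complex.exp (2 * Real.pi * Complex.I * z)‖ = Real.exp (-(2 * Real.pi * z.im)) := by
    simp [Complex.norm_exp]
  have hpos := Real.exp_pos (-(2 * Real.pi * z.im))
  rcases hz with hz | hz
  · have hcos : Real.cos (2 * Real.pi * z.re) = -1 := by
      rw [← Real.cos_abs, abs_mul, abs_of_pos Real.two_pi_pos, hz,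
        show 2 * Real.pi * ((N : ℝ) + 1 / 2) = Real.pi + N * (2 * Real.pi) by ring,
        Real.cos_add_nat_mul_two_pi, Real.cos_pi]
    have hre : (expKernel z).re = -(1 + Real.exp (-(2 * Real.pi * z.im))) := by
      simp only [expKernel, Complex.sub_re, Complex.exp_re, Complex.one_re]
      have h1 : (2 * Real.pi * Complex.I * z).re = -(2 * Real.pi * z.im) := by simp
      have h2 : (2 * Real.pi * Complex.I * z).im = 2 * Real.pi * z.re := by simp
      rw [h1, h2, hcos]; ring
    have := Complex.abs_re_le_norm (expKernel z)
    rw [hre, abs_neg, abs_of_pos (by positivity)] at this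
    have := max_le_add_of_nonneg zero_le_one hpos.le
    linarith
  · rcases le_abs.1 hz with h | h
    · have h1 : Real.exp (-(2 * Real.pi * z.im)) ≤ 1 / 2 := by
        rw [Real.exp_neg, one_div]
        refine inv_anti₀ two_pos ?_
        have := Real.add_one_le_exp (2 * Real.pi * z.im)
        nlinarith [Real.pi_gt_three]
      have h2 := norm_sub_norm_le (1 : ℂ) (Complex.exp (2 * Real.pi * Complex.I * z))
      rw [norm_sub_rev, hn, norm_one] at h2
      rw [max_eq_left (by linarith), expKernel]
      linarith
    · have h1 : 2 ≤ Real.exp (-(2 * Real.pi * z.im)) := by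
        have := Real.add_one_le_exp (-(2 * Real.pi * z.im))
        nlinarith [Real.pi_gt_three]
      have h2 := norm_sub_norm_le (Complex.exp (2 * Real.pi * Complex.I * z)) 1
      rw [hn, norm_one] at h2
      rw [max_eq_right (by linarith), expKernel]
      linarith

lemma dslope_comm {𝕜 E : Type*} [NontriviallyNormedField 𝕜] [NormedAddCommGroup E]
    [NormedSpace 𝕜 E] (f : 𝕜 → E) (a b : 𝕜) : dslope f a b = dslope f b a := by
  rcases eq_or_ne a b with rfl | h
  · rfl
  · rw [dslope_of_ne _ h.symm, dslope_of_ne _ h, slope_comm]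

lemma Differentiable.dslope {f : ℂ → ℂ} (hf : Differentiable ℂ f) (a : ℂ) :
    Differentiable ℂ (dslope f a) := by
  rw [← differentiableOn_univ] at hf ⊢
  exact (Complex.differentiableOn_dslope univ_mem).2 hf

/-- Divided differences of an entire function bounded on the real line decay like `1/(|t| + 1)`. -/
lemma exists_norm_dslope_le {F : ℂ → ℂ} (hF : Differentiable ℂ F) {C : ℝ}
    (hC : ∀ t : ℝ, ‖F t‖ ≤ C) (a : ℝ) :
    ∃ K : ℝ, 0 ≤ K ∧ ∀ t : ℝ, ‖dslope F a t‖ ≤ K / (|t| + 1) := by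
  have hfar (t : ℝ) : |t - a| * ‖dslope F a t‖ ≤ 2 * C := by
    have h := congrArg norm (sub_smul_dslope F (a : ℂ) (t : ℂ))
    rw [norm_smul, ← Complex.ofReal_sub, Complex.norm_real, Real.norm_eq_abs] at h
    rw [h]
    linarith [norm_sub_le (F t) (F a), hC t, hC a]
  have hC0 : 0 ≤ C := (norm_nonneg _).trans (hC 0)
  obtain ⟨M, hM⟩ := (isCompact_Icc (a := a - 1) (b := a + 1)).exists_bound_of_continuousOn
    (f := fun t : ℝ => dslope F a t)
    ((hF.dslope a).continuous.comp Complex.continuous_ofReal).continuousOn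
  have hM0 : 0 ≤ M := (norm_nonneg _).trans (hM a ⟨by linarith, by linarith⟩)
  have hb (t : ℝ) : ‖dslope F a t‖ ≤ M + 2 * C := by
    by_cases ht : |t - a| ≤ 1
    · have := hM t ⟨by linarith [abs_le.1 ht], by linarith [abs_le.1 ht]⟩
      linarith
    · have := hfar t
      nlinarith [norm_nonneg (dslope F a t)]
  refine ⟨2 * C + (|a| + 1) * (M + 2 * C), by positivity, fun t => ?_⟩
  rw [le_div_iff₀ (by positivity)]
  have h1 : |t| ≤ |t - a| + |a| := by simpa using abs_add_le (t - a) a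
  have h2 := hfar t
  have h3 : (|a| + 1) * ‖dslope F a t‖ ≤ (|a| + 1) * (M + 2 * C) := by gcongr; exact hb t
  nlinarith [norm_nonneg (dslope F a t), mul_le_mul_of_nonneg_left h1 (norm_nonneg (dslope F a t))]

/-- Removal of singularities of a quotient at simple zeros of the denominator. -/
lemma differentiableAt_removable_div {h e : ℂ → ℂ} (hh : Differentiable ℂ h)
    (he : Differentiable ℂ e) {z : ℂ} (hz : e z = 0 → h z = 0 ∧ deriv e z ≠ 0) :
    DifferentiableAt ℂ (fun w => if e w = 0 then deriv h w / deriv e w else h w / e w) z := by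
  by_cases h0 : e z = 0
  · obtain ⟨h1, h2⟩ := hz h0
    have hne : ∀ᶠ w in 𝓝 z, dslope e z w ≠ 0 :=
      (he.dslope z).continuous.continuousAt.eventually_ne (by rwa [dslope_same])
    refine (((hh.dslope z) z).div ((he.dslope z) z) (by rwa [dslope_same])).congr_of_eventuallyEq ?_
    filter_upwards [hne] with w hw
    rcases eq_or_ne w z with rfl | hwz
    · simp [h0, dslope_same]
    · have hsub := sub_ne_zero.2 hwz
      have e1 : (w - z) * dslope e z w = e w := by simpa [h0] using sub_smul_dslope e z w
      have e2 : (w - z) * dslope h z w = h w := by simpa [h1] using sub_smul_dslope h z w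
      have : e w ≠ 0 := by rw [← e1]; exact mul_ne_zero hsub hw
      rw [if_neg this, ← e1, ← e2, Pi.div_apply, mul_div_mul_left _ _ hsub]
  · refine ((hh z).div (he z) h0).congr_of_eventuallyEq ?_
    filter_upwards [he.continuous.continuousAt.eventually_ne h0] with w hw
    rw [if_neg hw, Pi.div_apply]

lemma sum_Icc_inv_mul_inv_le (N : ℕ) :
    ∑ n ∈ Finset.Icc (-N : ℤ) N, 1 / ((|(n : ℝ)| + 1) * (N + 1 - |(n : ℝ)|)) ≤
      4 * ((((N + 1 : ℕ) : ℝ))⁻¹ * ∑ k ∈ Finset.range (N + 1), 1 / ((k : ℝ) + 1)) := by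
  rw [Finset.sum_Icc_of_even_eq_range (fun n => by simp)]
  have h0 : (0 : ℝ) ≤ 1 / ((|((0 : ℤ) : ℝ)| + 1) * (N + 1 - |((0 : ℤ) : ℝ)|)) := by
    simp only [Int.cast_zero, abs_zero, sub_zero]; positivity
  have hterm : ∀ k ∈ Finset.range (N + 1),
      1 / ((|((k : ℤ) : ℝ)| + 1) * (N + 1 - |((k : ℤ) : ℝ)|)) =
        ((N : ℝ) + 2)⁻¹ * (1 / ((k : ℝ) + 1) + 1 / (((N + 1 - 1 - k : ℕ) : ℝ) + 1)) := by
    intro k hk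
    have hk' : k ≤ N := Nat.lt_succ_iff.1 (Finset.mem_range.1 hk)
    have hkN : (k : ℝ) ≤ N := by exact_mod_cast hk'
    have h2 : (N : ℝ) + 1 - k ≠ 0 := by linarith
    have h3 : (N : ℝ) - k + 1 ≠ 0 := by linarith
    rw [Int.cast_natCast, Nat.abs_cast, Nat.add_sub_cancel, Nat.cast_sub hk']
    field_simp
    ring
  rw [Finset.sum_congr rfl hterm, ← Finset.mul_sum, Finset.sum_add_distrib,
    Finset.sum_range_reflect (fun k : ℕ => 1 / ((k : ℝ) + 1)) (N + 1)]
  set S := ∑ k ∈ Finset.range (N + 1), 1 / ((k : ℝ) + 1)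
  have hS : 0 ≤ S := Finset.sum_nonneg fun k _ => by positivity
  have hinv : ((N : ℝ) + 2)⁻¹ ≤ (((N + 1 : ℕ) : ℝ))⁻¹ := by
    apply inv_anti₀ (by positivity); push_cast; linarith
  have := mul_le_mul_of_nonneg_right hinv hS
  simp only [nsmul_eq_mul, Nat.cast_ofNat]
  nlinarith

lemma abs_re_eq_or_abs_im_eq_of_mem_frontier_square {r : ℝ} (hr : 0 < r) {z : ℂ}
    (hz : z ∈ frontier (Ioo (-r) r ×ℂ Ioo (-r) r)) : |z.re| = r ∨ |z.im| = r := by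
  have hne : -r ≠ r := by linarith
  rw [Complex.frontier_reProdIm, closure_Ioo hne, frontier_Ioo (by linarith)] at hz
  have key (t : ℝ) (ht : t ∈ ({-r, r} : Set ℝ)) : |t| = r := by
    rcases ht with rfl | rfl
    · rw [abs_neg, abs_of_pos hr]
    · exact abs_of_pos hr
  rcases hz with hz | hz
  · exact Or.inr (key _ hz.2)
  · exact Or.inl (key _ hz.1)

/-- Cardinal series for divided differences, with symmetric partial sums. -/
lemma tendsto_sum_dslope_mul_dslope_expKernel {F : ℂ → ℂ} (hF : Differentiable ℂ F) {C : ℝ}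
    (hC : ∀ z : ℂ, ‖F z‖ ≤ C * max 1 (Real.exp (-(2 * Real.pi * z.im)))) (a b : ℝ) :
    Tendsto (fun N : ℕ => ∑ n ∈ Finset.Icc (-N : ℤ) N,
      dslope F a n * (dslope expKernel n b / (2 * Real.pi * Complex.I)))
      atTop (𝓝 (dslope F a b)) := by
  have hreal (t : ℝ) : ‖F t‖ ≤ C := by simpa using hC t
  have hC0 : 0 ≤ C := (norm_nonneg _).trans (hreal 0)
  have h2pi : (2 * Real.pi * Complex.I : ℂ) ≠ 0 := by simp [Real.pi_ne_zero]
  have hn2pi : ‖(2 * Real.pi * Complex.I : ℂ)‖ = 2 * Real.pi := by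
    simp [abs_of_pos Real.pi_pos]
  obtain ⟨K, hK0, hK⟩ := exists_norm_dslope_le hF hreal a
  set c : ℕ → ℝ := fun N => (((N + 1 : ℕ) : ℝ))⁻¹ * ∑ k ∈ Finset.range (N + 1), 1 / ((k : ℝ) + 1)
  have hc : Tendsto c atTop (𝓝 0) :=
    (tendsto_one_div_add_atTop_nhds_zero_nat (𝕜 := ℝ)).cesaro.comp (tendsto_add_atTop_nat 1)
  have hB : Tendsto (fun N : ℕ => 2 * (4 * C / (N - |a|) + K * (4 * c N))) atTop (𝓝 0) := by
    have h1 : Tendsto (fun N : ℕ => 4 * C / ((N : ℝ) - |a|)) atTop (𝓝 0) :=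
      tendsto_const_nhds.div_atTop
        (tendsto_atTop_add_const_right _ _ tendsto_natCast_atTop_atTop)
    simpa using (h1.add ((hc.const_mul 4).const_mul K)).const_mul 2
  rw [tendsto_iff_norm_sub_tendsto_zero]
  refine squeeze_zero' (.of_forall fun _ => norm_nonneg _) ?_ hB
  filter_upwards [tendsto_natCast_atTop_atTop.eventually_ge_atTop (|a| + 1),
    tendsto_natCast_atTop_atTop.eventually_ge_atTop |b|] with N hNa hNb
  set h : ℂ → ℂ := fun z => dslope F a z - ∑ n ∈ Finset.Icc (-N : ℤ) N,
      dslope F a n * (dslope expKernel n z / (2 * Real.pi * Complex.I)) with hh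
  have hdiff : Differentiable ℂ h := by
    refine (hF.dslope a).sub (Differentiable.fun_sum fun n _ => ?_)
    exact ((differentiable_expKernel.dslope n).div_const _).const_mul _
  have hzero (m : ℤ) (hm : m ∈ Finset.Icc (-N : ℤ) N) : h m = 0 := by
    simp only [hh]
    rw [Finset.sum_eq_single_of_mem m hm]
    · rw [dslope_same expKernel, deriv_expKernel_intCast, div_self h2pi, mul_one, sub_self]
    · intro n _ hnm
      rw [dslope_expKernel_intCast_of_ne hnm.symm, zero_div, mul_zero]
  set q : ℂ → ℂ := fun w =>
    if expKernel w = 0 then deriv h w / deriv expKernel w else h w / expKernel w with hq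
  set r : ℝ := N + 1 / 2 with hr
  have hr0 : 0 < r := by positivity
  set U : Set ℂ := Ioo (-r) r ×ℂ Ioo (-r) r with hU
  have hUcl : closure U = Icc (-r) r ×ℂ Icc (-r) r := by
    rw [hU, Complex.closure_reProdIm, closure_Ioo (by linarith)]
  have hqd : DifferentiableOn ℂ q (closure U) := by
    intro z hz
    refine (differentiableAt_removable_div hdiff differentiable_expKernel
      fun h0 => ?_).differentiableWithinAt
    obtain ⟨m, rfl⟩ := expKernel_eq_zero_iff.1 h0
    refine ⟨hzero m ?_, by rwa [deriv_expKernel_intCast]⟩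
    rw [hUcl] at hz
    have h1 := hz.1
    simp only [mem_preimage, Complex.intCast_re, mem_Icc] at h1
    have h2 : -((N : ℝ) + 1) < m := by linarith [h1.1]
    have h3 : (m : ℝ) < (N : ℝ) + 1 := by linarith [h1.2]
    have h4 : -((N : ℤ) + 1) < m := by exact_mod_cast h2
    have h5 : m < (N : ℤ) + 1 := by exact_mod_cast h3
    rw [Finset.mem_Icc]; omega
  have hfr : ∀ z ∈ frontier U, ‖q z‖ ≤ 4 * C / (N - |a|) + K * (4 * c N) := by
    intro z hz
    have hz' := abs_re_eq_or_abs_im_eq_of_mem_frontier_square hr0 hz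
    have hlow : 1 / 2 * max 1 (Real.exp (-(2 * Real.pi * z.im))) ≤ ‖expKernel z‖ :=
      half_max_le_norm_expKernel N (hz'.imp_right fun h => by
        rw [h, hr]; linarith [Nat.cast_nonneg (α := ℝ) N])
    set m := max 1 (Real.exp (-(2 * Real.pi * z.im)))
    have hm : 1 ≤ m := le_max_left _ _
    have hE : 0 < ‖expKernel z‖ := lt_of_lt_of_le (by linarith) hlow
    have hE0 : expKernel z ≠ 0 := norm_pos_iff.1 hE
    have hzr : r ≤ ‖z‖ := by
      rcases hz' with h | h
      · exact h ▸ Complex.abs_re_le_norm z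
      · exact h ▸ Complex.abs_im_le_norm z
    have hdist (t : ℝ) : r - |t| ≤ ‖z - t‖ := by
      have := norm_sub_norm_le z t
      rw [Complex.norm_real, Real.norm_eq_abs] at this
      linarith
    have hqz : q z = dslope F a z / expKernel z - ∑ n ∈ Finset.Icc (-N : ℤ) N,
        dslope F a n / ((z - n) * (2 * Real.pi * Complex.I)) := by
      simp only [hq, hh]
      rw [if_neg hE0, sub_div, Finset.sum_div]
      congr 1
      refine Finset.sum_congr rfl fun n _ => ?_
      have hzn : z ≠ n := fun h => hE0 (h ▸ expKernel_intCast n)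
      have := sub_ne_zero.2 hzn
      rw [dslope_of_ne _ hzn, slope_def_field, expKernel_intCast, sub_zero]
      field_simp
    rw [hqz]
    refine (norm_sub_le _ _).trans (add_le_add ?_ ?_)
    · have hza : (N : ℝ) - |a| ≤ ‖z - a‖ := by linarith [hdist a]
      have hpos : 0 < (N : ℝ) - |a| := by linarith
      have h1 := congrArg norm (sub_smul_dslope F (a : ℂ) z)
      rw [norm_smul] at h1
      have h2 : ‖F z - F a‖ ≤ 2 * C * m := by
        have := norm_sub_le (F z) (F a)
        nlinarith [hC z, hreal a]
      rw [norm_div, div_le_div_iff₀ hE hpos]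
      have h3 := mul_le_mul_of_nonneg_right hza (norm_nonneg (dslope F a z))
      nlinarith
    · refine (norm_sum_le _ _).trans ?_
      refine le_trans ?_ (mul_le_mul_of_nonneg_left (sum_Icc_inv_mul_inv_le N) hK0)
      rw [Finset.mul_sum]
      refine Finset.sum_le_sum fun n hn => ?_
      have hnN : |(n : ℝ)| ≤ N := by
        rw [Finset.mem_Icc] at hn
        exact_mod_cast abs_le.2 hn
      have h1 : ‖dslope F a n‖ ≤ K / (|(n : ℝ)| + 1) := by simpa using hK n
      have h2 : (N : ℝ) + 1 - |(n : ℝ)| ≤ ‖z - n‖ * (2 * Real.pi) := by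
        have h3 : r - |(n : ℝ)| ≤ ‖z - n‖ := by simpa using hdist n
        nlinarith [Real.pi_gt_three]
      have h4 : 0 < (N : ℝ) + 1 - |(n : ℝ)| := by linarith
      rw [norm_div, norm_mul, hn2pi]
      calc ‖dslope F a n‖ / (‖z - n‖ * (2 * Real.pi))
          ≤ K / (|(n : ℝ)| + 1) / (N + 1 - |(n : ℝ)|) := by gcongr
        _ = K * (1 / ((|(n : ℝ)| + 1) * (N + 1 - |(n : ℝ)|))) := by
          rw [div_div, mul_one_div]
  have hbU : (b : ℂ) ∈ closure U := by
    have := abs_le.1 hNb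
    rw [hUcl]
    refine ⟨⟨?_, ?_⟩, ⟨?_, ?_⟩⟩ <;> simp only [Complex.ofReal_re, Complex.ofReal_im] <;> linarith
  have hqb := Complex.norm_le_of_forall_mem_frontier_norm_le
    ((Metric.isBounded_Ioo _ _).reProdIm (Metric.isBounded_Ioo _ _)) hqd.diffContOnCl hfr hbU
  rw [norm_sub_rev]
  change ‖h b‖ ≤ _
  have hhb : h b = expKernel b * q b := by
    by_cases h0 : expKernel b = 0
    · obtain ⟨m, hm⟩ := expKernel_eq_zero_iff.1 h0
      have hmb : b = m := by exact_mod_cast hm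
      rw [h0, zero_mul, hm]
      refine hzero m ?_
      rw [hmb] at hNb
      have : |m| ≤ (N : ℤ) := by exact_mod_cast hNb
      rw [Finset.mem_Icc]
      exact abs_le.1 this
    · simp only [hq]
      rw [if_neg h0, mul_div_cancel₀ _ h0]
  rw [hhb, norm_mul]
  gcongr
  exact norm_expKernel_ofReal_le b

lemma hasSum_dslope_mul_dslope_expKernel {F : ℂ → ℂ} (hF : Differentiable ℂ F) {C : ℝ}
    (hC : ∀ z : ℂ, ‖F z‖ ≤ C * max 1 (Real.exp (-(2 * Real.pi * z.im)))) (a b : ℝ) :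
    Summable (fun n : ℤ => ‖dslope F a n * (dslope expKernel n b / (2 * Real.pi * Complex.I))‖) ∧
    HasSum (fun n : ℤ => dslope F a n * (dslope expKernel n b / (2 * Real.pi * Complex.I)))
      (dslope F a b) := by
  have hreal (t : ℝ) : ‖F t‖ ≤ C := by simpa using hC t
  obtain ⟨K, hK0, hK⟩ := exists_norm_dslope_le hF hreal a
  obtain ⟨L, hL0, hL⟩ :=
    exists_norm_dslope_le differentiable_expKernel norm_expKernel_ofReal_le b
  have hsum : Summable
      (fun n : ℤ => ‖dslope F a n * (dslope expKernel n b / (2 * Real.pi * Complex.I))‖) := by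
    have hs := ((Real.summable_one_div_int_pow (p := 2)).2 one_lt_two).mul_left
      (K * L / (2 * Real.pi))
    refine hs.of_norm_bounded_eventually ?_
    filter_upwards [(finite_singleton (0 : ℤ)).compl_mem_cofinite] with n hn
    have hn0 : (0 : ℝ) < |(n : ℝ)| := abs_pos.2 (by exact_mod_cast hn)
    have h1 : ‖dslope F a n‖ ≤ K / |(n : ℝ)| := by
      have : ‖dslope F a n‖ ≤ K / (|(n : ℝ)| + 1) := by simpa using hK n
      exact this.trans (by gcongr; linarith)
    have h2 : ‖dslope expKernel n b‖ ≤ L / |(n : ℝ)| := by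
      have : ‖dslope expKernel b n‖ ≤ L / (|(n : ℝ)| + 1) := by simpa using hL n
      rw [dslope_comm]
      exact this.trans (by gcongr; linarith)
    have hn2pi : ‖(2 * Real.pi * Complex.I : ℂ)‖ = 2 * Real.pi := by
      simp [abs_of_pos Real.pi_pos]
    rw [norm_norm, norm_mul, norm_div, hn2pi]
    calc ‖dslope F a n‖ * (‖dslope expKernel n b‖ / (2 * Real.pi))
        ≤ K / |(n : ℝ)| * (L / |(n : ℝ)| / (2 * Real.pi)) := by
          have := Real.pi_pos
          gcongr
      _ = K * L / (2 * Real.pi) * (1 / (n : ℝ) ^ 2) := by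
          rw [← sq_abs (n : ℝ)]; field_simp
  refine ⟨hsum, ?_⟩
  have hs := hsum.of_norm.hasSum
  have ht := hs.comp Finset.tendsto_Icc_neg
  rwa [tendsto_nhds_unique ht (tendsto_sum_dslope_mul_dslope_expKernel hF hC a b)] at hs

lemma sincFac_eq_dslope_expKernel (σ : ℝ) (n : ℤ) (y : ℝ) :
    sincFac σ n y =
      dslope expKernel n ((σ * y / (2 * Real.pi) : ℝ) : ℂ) / (2 * Real.pi * Complex.I) := by
  have hpi : (Real.pi : ℂ) ≠ 0 := by exact_mod_cast Real.pi_ne_zero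
  have h2pi : (2 * Real.pi * Complex.I : ℂ) ≠ 0 := by simp [Real.pi_ne_zero]
  by_cases h : σ * y = 2 * Real.pi * n
  · have : ((σ * y / (2 * Real.pi) : ℝ) : ℂ) = n := by
      rw [h, mul_div_cancel_left₀ _ Real.two_pi_pos.ne', Complex.ofReal_intCast]
    rw [sincFac, if_pos h, this, dslope_same, deriv_expKernel_intCast, div_self h2pi]
  · have hne : ((σ * y / (2 * Real.pi) : ℝ) : ℂ) ≠ n := by
      rw [← Complex.ofReal_intCast, Ne, Complex.ofReal_inj, div_eq_iff Real.two_pi_pos.ne']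
      rwa [mul_comm (n : ℝ)]
    have hE : expKernel ((σ * y / (2 * Real.pi) : ℝ) : ℂ) =
        Complex.exp (Complex.I * ((σ * y : ℝ) : ℂ)) - 1 := by
      rw [expKernel]; congr 2; push_cast; field_simp
    have hden : (Complex.I * (((σ * y : ℝ) : ℂ) - ((2 * Real.pi * n : ℝ) : ℂ))) =
        (((σ * y / (2 * Real.pi) : ℝ) : ℂ) - n) * (2 * Real.pi * Complex.I) := by
      push_cast; field_simp
    rw [sincFac, if_neg h, dslope_of_ne _ hne, slope_def_field, expKernel_intCast, sub_zero, hE,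
      hden, div_div]

lemma MemEInftyPlus.exists_norm_rescale_le {σ : ℝ} (hσ : 0 < σ) {f : ℂ → ℂ}
    (hf : MemEInftyPlus σ f) :
    ∃ C : ℝ, ∀ z : ℂ, ‖f ((2 * Real.pi / σ : ℝ) * z)‖ ≤
      C * max 1 (Real.exp (-(2 * Real.pi * z.im))) := by
  obtain ⟨-, ⟨A, hA⟩, B, hB⟩ := hf
  have hs : 0 < 2 * Real.pi / σ := div_pos Real.two_pi_pos hσ
  have hA0 : 0 ≤ A := (norm_nonneg _).trans (hA 0 le_rfl)
  refine ⟨max A B, fun z => ?_⟩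
  have him : (((2 * Real.pi / σ : ℝ) : ℂ) * z).im = 2 * Real.pi / σ * z.im :=
    Complex.im_ofReal_mul _ _
  have hM : 0 ≤ max A B := hA0.trans (le_max_left _ _)
  rcases le_total 0 z.im with hz | hz
  · calc _ ≤ A := hA _ (by rw [him]; positivity)
      _ ≤ max A B * 1 := by rw [mul_one]; exact le_max_left _ _
      _ ≤ _ := by gcongr; exact le_max_left _ _
  · have h := hB (((2 * Real.pi / σ : ℝ) : ℂ) * z)
      (by rw [him]; exact mul_nonpos_of_nonneg_of_nonpos hs.le hz)
    have hre : (-(Complex.I * (σ : ℂ) * (((2 * Real.pi / σ : ℝ) : ℂ) * z))).re =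
        2 * Real.pi * z.im := by
      have h0 : (σ : ℂ) ≠ 0 := by exact_mod_cast hσ.ne'
      have : Complex.I * (σ : ℂ) * (((2 * Real.pi / σ : ℝ) : ℂ) * z) =
          ((2 * Real.pi : ℝ) : ℂ) * (Complex.I * z) := by push_cast; field_simp
      rw [this, Complex.neg_re, Complex.re_ofReal_mul, Complex.I_mul_re]; ring
    rw [norm_mul, Complex.norm_exp, hre, mul_comm, ← le_div_iff₀ (Real.exp_pos _),
      div_eq_mul_inv B, ← Real.exp_neg] at h
    refine h.trans ?_
    gcongr
    · exact le_max_right _ _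
    · exact le_max_right _ _

/-- For `f ∈ (ℰ_σ^∞)₊` and real `x ≠ y` with `σx ∉ 2πℤ`, the series
`∑_{n∈ℤ} σ (f(x) − f(2πn/σ))/(σx − 2πn) · (e^{iσy} − 1)/(i(σy − 2πn))` converges
absolutely and its sum is the divided difference `(f(x) − f(y))/(x − y)`. -/
theorem divided_difference_series (σ : ℝ) (hσ : 0 < σ) (f : ℂ → ℂ)
    (hf : MemEInftyPlus σ f) (x y : ℝ) (hxy : x ≠ y)
    (hx : ∀ n : ℤ, σ * x ≠ 2 * Real.pi * n) :
    Summable (fun n : ℤ =>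
      ‖(σ : ℂ) * (f (x : ℂ) - f ((2 * Real.pi * n / σ : ℝ) : ℂ)) /
          (((σ * x : ℝ) : ℂ) - ((2 * Real.pi * n : ℝ) : ℂ)) * sincFac σ n y‖) ∧
    HasSum (fun n : ℤ =>
      (σ : ℂ) * (f (x : ℂ) - f ((2 * Real.pi * n / σ : ℝ) : ℂ)) /
          (((σ * x : ℝ) : ℂ) - ((2 * Real.pi * n : ℝ) : ℂ)) * sincFac σ n y)
      ((f (x : ℂ) - f (y : ℂ)) / ((x : ℂ) - (y : ℂ))) := by
  obtain ⟨C, hC⟩ := hf.exists_norm_rescale_le hσ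
  have hF : Differentiable ℂ fun z : ℂ => f ((2 * Real.pi / σ : ℝ) * z) :=
    hf.1.comp (differentiable_id.const_mul _)
  have h := hasSum_dslope_mul_dslope_expKernel hF hC (σ * x / (2 * Real.pi))
    (σ * y / (2 * Real.pi))
  have hσ0 : (σ : ℂ) ≠ 0 := by exact_mod_cast hσ.ne'
  have hpi : (Real.pi : ℂ) ≠ 0 := by exact_mod_cast Real.pi_ne_zero
  have harg (t : ℝ) :
      ((2 * Real.pi / σ : ℝ) : ℂ) * ((σ * t / (2 * Real.pi) : ℝ) : ℂ) = t := by
    push_cast; field_simp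
  have hargn (n : ℤ) :
      ((2 * Real.pi / σ : ℝ) : ℂ) * (n : ℂ) = ((2 * Real.pi * n / σ : ℝ) : ℂ) := by
    push_cast; field_simp
  have hterm (n : ℤ) :
      dslope (fun z : ℂ => f ((2 * Real.pi / σ : ℝ) * z)) ((σ * x / (2 * Real.pi) : ℝ) : ℂ) n =
        2 * Real.pi / σ * ((σ : ℂ) * (f (x : ℂ) - f ((2 * Real.pi * n / σ : ℝ) : ℂ)) /
          (((σ * x : ℝ) : ℂ) - ((2 * Real.pi * n : ℝ) : ℂ))) := by
    have hd : ((σ * x : ℝ) : ℂ) - ((2 * Real.pi * n : ℝ) : ℂ) ≠ 0 :=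
      sub_ne_zero.2 (by exact_mod_cast hx n)
    have hd' : (n : ℂ) - ((σ * x / (2 * Real.pi) : ℝ) : ℂ) =
        -(((σ * x : ℝ) : ℂ) - ((2 * Real.pi * n : ℝ) : ℂ)) / (2 * Real.pi) := by
      push_cast; field_simp; ring
    have hne : (n : ℂ) ≠ ((σ * x / (2 * Real.pi) : ℝ) : ℂ) := by
      rw [← sub_ne_zero, hd']
      exact div_ne_zero (neg_ne_zero.2 hd) (by simp [Real.pi_ne_zero])
    rw [dslope_of_ne _ hne, slope_def_field, harg, hargn, hd']
    field_simp
    ring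
  have hval : dslope (fun z : ℂ => f ((2 * Real.pi / σ : ℝ) * z))
      ((σ * x / (2 * Real.pi) : ℝ) : ℂ) ((σ * y / (2 * Real.pi) : ℝ) : ℂ) =
        2 * Real.pi / σ * ((f (x : ℂ) - f (y : ℂ)) / ((x : ℂ) - (y : ℂ))) := by
    have hd : (x : ℂ) - y ≠ 0 := sub_ne_zero.2 (by exact_mod_cast hxy)
    have hd' : ((σ * y / (2 * Real.pi) : ℝ) : ℂ) - ((σ * x / (2 * Real.pi) : ℝ) : ℂ) =
        -((x : ℂ) - y) * σ / (2 * Real.pi) := by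
      push_cast; field_simp; ring
    have hne : ((σ * y / (2 * Real.pi) : ℝ) : ℂ) ≠ ((σ * x / (2 * Real.pi) : ℝ) : ℂ) := by
      rw [← sub_ne_zero, hd']
      exact div_ne_zero (mul_ne_zero (neg_ne_zero.2 hd) hσ0) (by simp [Real.pi_ne_zero])
    rw [dslope_of_ne _ hne, slope_def_field, harg, harg, hd']
    field_simp
    ring
  have hc : (2 * Real.pi / σ : ℂ) ≠ 0 := div_ne_zero (by simp [Real.pi_ne_zero]) hσ0
  simp only [hterm, hval, ← sincFac_eq_dslope_expKernel, mul_assoc (2 * Real.pi / σ : ℂ)] at h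
  simp only [norm_mul (2 * Real.pi / σ : ℂ)] at h
  rwa [summable_mul_left_iff (norm_ne_zero_iff.2 hc), hasSum_mul_left_iff hc] at h
end

section
/- Let σ > 0 and f ∈ (ℰ_σ^∞)_+. Then for all x, y ∈ ℝ with x ≠ y, the function t ↦ (f(x) − f(t))/(x − t) · (e^{iσ(y−t)} − 1)/(y − t) (defined for t ∈ ℝ \ {x, y}) is Lebesgue integrable on ℝ and (f(x) − f(y))/(x − y) = (1/(2πi)) ∫_ℝ (f(x) − f(t))/(x − t) · (e^{iσ(y−t)} − 1)/(y − t) dt. -/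
open MeasureTheory

open Filter Asymptotics Topology

/-- A function that is continuous on the closed upper half-plane, holomorphic on the open one and
`O(‖z‖⁻²)` at infinity is integrable over the real line, with vanishing integral. -/
theorem integrable_and_integral_eq_zero_of_upperHalfPlane {H : ℂ → ℂ} {K R₀ : ℝ}
    (hc : ContinuousOn H {z | 0 ≤ z.im}) (hd : DifferentiableOn ℂ H {z | 0 < z.im})
    (hK : ∀ z : ℂ, 0 ≤ z.im → R₀ ≤ ‖z‖ → ‖H z‖ ≤ K / ‖z‖ ^ 2) :
    Integrable (fun t : ℝ => H t) ∧ ∫ t : ℝ, H t = 0 := by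
  have hcont : Continuous (fun t : ℝ => H t) :=
    hc.comp_continuous Complex.continuous_ofReal (by simp)
  have hint : Integrable (fun t : ℝ => H t) := by
    refine hcont.locallyIntegrable.integrable_of_isBigO_cocompact
      (g := fun t : ℝ => (1 + t ^ 2)⁻¹) ?_ (integrable_inv_one_add_sq.integrableAtFilter _)
    refine IsBigO.of_bound (2 * |K|) ?_
    filter_upwards [(tendsto_norm_cocompact_atTop (E := ℝ)).eventually_ge_atTop (max R₀ 1)]
      with t ht
    have h1 : 1 ≤ |t| := (le_max_right _ _).trans ht
    have h2 : 1 ≤ t ^ 2 := by rw [← sq_abs]; nlinarith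
    have h3 := hK t (by simp) (by simpa using (le_max_left _ _).trans ht)
    rw [Complex.norm_real, Real.norm_eq_abs, sq_abs] at h3
    refine h3.trans ?_
    rw [Real.norm_of_nonneg (by positivity), ← div_eq_mul_inv,
      div_le_div_iff₀ (by positivity) (by positivity)]
    nlinarith [le_abs_self K, abs_nonneg K, mul_le_mul_of_nonneg_left h2 (abs_nonneg K)]
  refine ⟨hint, ?_⟩
  have hlim : Tendsto (fun R : ℝ => ∫ t in (-R)..R, H t) atTop (𝓝 (∫ t : ℝ, H t)) :=
    intervalIntegral_tendsto_integral hint tendsto_neg_atTop_atBot tendsto_id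
  refine tendsto_nhds_unique hlim ?_
  have hzero : Tendsto (fun R : ℝ => 4 * |K| / R) atTop (𝓝 0) :=
    tendsto_const_nhds.div_atTop tendsto_id
  refine squeeze_zero_norm' ?_ hzero
  filter_upwards [eventually_ge_atTop (max R₀ 1)] with R hR
  have hR1 : 1 ≤ R := (le_max_right _ _).trans hR
  have hR0 : 0 < R := by linarith
  have hbd : ∀ z : ℂ, 0 ≤ z.im → R ≤ ‖z‖ → ‖H z‖ ≤ |K| / R ^ 2 := by
    intro z hz hRz
    refine (hK z hz ((le_max_left _ _).trans (hR.trans hRz))).trans ?_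
    gcongr
    exact le_abs_self K
  have key := Complex.integral_boundary_rect_eq_zero_of_continuousOn_of_differentiableOn H
    ((-R : ℝ) : ℂ) (R + R * Complex.I) (hc.mono ?_) (hd.mono ?_)
  rotate_left
  · rintro z ⟨-, hz⟩
    simp only [Set.mem_preimage, Complex.ofReal_im, Complex.add_im, Complex.mul_im,
      Complex.ofReal_re, Complex.I_im, Complex.I_re, mul_one, mul_zero, add_zero, zero_add,
      Set.uIcc_of_le hR0.le] at hz
    exact hz.1
  · rintro z ⟨-, hz⟩
    simp only [Set.mem_preimage, Complex.ofReal_im, Complex.add_im, Complex.mul_im,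
      Complex.ofReal_re, Complex.I_im, Complex.I_re, mul_one, mul_zero, add_zero, zero_add,
      min_eq_left hR0.le] at hz
    exact hz.1
  simp only [Complex.ofReal_im, Complex.ofReal_re, Complex.add_im, Complex.mul_im, Complex.add_re,
    Complex.mul_re, Complex.I_im, Complex.I_re, mul_one, mul_zero, add_zero, zero_add, sub_zero,
    Complex.ofReal_zero, zero_mul, smul_eq_mul] at key
  have htop : ‖∫ x : ℝ in (-R)..R, H (x + R * Complex.I)‖ ≤ |K| / R ^ 2 * |R - -R| := by
    refine intervalIntegral.norm_integral_le_of_norm_le_const fun x _ =>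
      hbd _ (by simpa using hR0.le) ?_
    refine le_trans ?_ (Complex.abs_im_le_norm _)
    simpa using le_abs_self R
  have hside : ∀ a : ℝ, |a| = R →
      ‖∫ y : ℝ in (0)..R, H (a + y * Complex.I)‖ ≤ |K| / R ^ 2 * |R - 0| := by
    intro a ha
    refine intervalIntegral.norm_integral_le_of_norm_le_const fun y hy => hbd _ ?_ ?_
    · rw [Set.uIoc_of_le hR0.le] at hy
      simpa using hy.1.le
    · refine le_trans ?_ (Complex.abs_re_le_norm _)
      simp [ha]
  have hr := hside R (abs_of_pos hR0)
  have hl := hside (-R) (by rw [abs_neg, abs_of_pos hR0])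
  have heq : ∫ t : ℝ in (-R)..R, H t = (∫ x : ℝ in (-R)..R, H (x + R * Complex.I)) -
      Complex.I * (∫ y : ℝ in (0)..R, H (R + y * Complex.I)) +
      Complex.I * (∫ y : ℝ in (0)..R, H ((-R : ℝ) + y * Complex.I)) := by
    linear_combination key
  rw [heq]
  calc _ ≤ |K| / R ^ 2 * |R - -R| + |K| / R ^ 2 * |R - 0| + |K| / R ^ 2 * |R - 0| := by
        refine (norm_add_le _ _).trans (add_le_add ((norm_sub_le _ _).trans
          (add_le_add htop ?_)) ?_)
        · simpa using hr
        · simpa using hl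
    _ = 4 * |K| / R := by
        rw [sub_neg_eq_add, sub_zero, abs_of_pos (add_pos hR0 hR0), abs_of_pos hR0]
        field_simp
        ring

theorem isBigO_inv_sub_cobounded (a : ℂ) :
    (fun z : ℂ => (z - a)⁻¹) =O[Bornology.cobounded ℂ] fun z => z⁻¹ := by
  refine (spectrum.resolvent_isBigO_inv (𝕜 := ℂ) a).congr (fun z => ?_) fun z => rfl
  rw [resolvent, Ring.inverse_eq_inv', Algebra.algebraMap_self_apply]

/-- For `F` entire and bounded on the closed upper half-plane with `F x = 0`, subtracting the polar
part of `F(z) / ((z - x)(z - y))` at `y`, damped by a factor holomorphic in the upper half-plane,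
leaves an integrable function with vanishing integral over the real line. -/
theorem integrable_and_integral_eq_zero_sub_polar {F : ℂ → ℂ} {C : ℝ} (hF : Differentiable ℂ F)
    (hC : ∀ z : ℂ, 0 ≤ z.im → ‖F z‖ ≤ C) {x y : ℝ} (hxy : x ≠ y) (hx : F x = 0) :
    Integrable (fun t : ℝ => F t / ((t - x) * (t - y)) -
      F y / (y - x) * (Complex.I / ((t - y) * (t - y + Complex.I)))) ∧
    ∫ t : ℝ, (F t / ((t - x) * (t - y)) -
      F y / (y - x) * (Complex.I / ((t - y) * (t - y + Complex.I)))) = 0 := by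
  set c : ℂ := F y / (y - x) with hcdef
  have hyx : (y : ℂ) - x ≠ 0 := sub_ne_zero.2 (by exact_mod_cast hxy.symm)
  set N : ℂ → ℂ := fun z => dslope F x z - c * (Complex.I / (z - y + Complex.I)) with hN
  set U : Set ℂ := {z | -1 < z.im} with hU
  have hUo : IsOpen U := isOpen_lt continuous_const Complex.continuous_im
  have hden : ∀ z ∈ U, z - y + Complex.I ≠ 0 := by
    intro z hz h
    have := congrArg Complex.im h
    simp at this
    simp only [hU, Set.mem_ofPred_eq] at hz
    linarith
  have hNd : DifferentiableOn ℂ N U := by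
    have h1 : DifferentiableOn ℂ (dslope F x) Set.univ :=
      (Complex.differentiableOn_dslope univ_mem).2 hF.differentiableOn
    refine (h1.mono (Set.subset_univ _)).sub ((DifferentiableOn.div (by fun_prop) (by fun_prop)
      hden).const_mul c)
  have hyU : (y : ℂ) ∈ U := by simp [hU]
  have hHd : DifferentiableOn ℂ (dslope N y) U :=
    (Complex.differentiableOn_dslope (hUo.mem_nhds hyU)).2 hNd
  have hNy : N y = 0 := by
    have : (y : ℂ) ≠ x := sub_ne_zero.1 hyx
    simp [hN, dslope_of_ne _ this, slope_def_field, hx, ← hcdef]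
  have hform : ∀ z : ℂ, z ≠ x → z ≠ y → dslope N y z = F z / ((z - x) * (z - y)) -
      c * (Complex.I / ((z - y) * (z - y + Complex.I))) := by
    intro z hzx hzy
    rw [dslope_of_ne _ hzy, slope_def_field, hNy]
    simp only [hN]
    rw [dslope_of_ne _ hzx, slope_def_field, hx, sub_zero, sub_zero, sub_div, div_div, mul_div_assoc,
      div_div, mul_comm (z - y + Complex.I)]
  have hO : dslope N y =O[Bornology.cobounded ℂ ⊓ 𝓟 {z | 0 ≤ z.im}] fun z => z⁻¹ * z⁻¹ := by
    set l := Bornology.cobounded ℂ ⊓ 𝓟 {z : ℂ | 0 ≤ z.im} with hl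
    have hll : l ≤ Bornology.cobounded ℂ := inf_le_left
    have hFO : F =O[l] fun _ => (1 : ℂ) := by
      refine IsBigO.of_bound C ?_
      filter_upwards [mem_inf_of_right (mem_principal_self _)] with z hz
      simpa using hC z hz
    have hx' := (isBigO_inv_sub_cobounded x).mono hll
    have hy' := (isBigO_inv_sub_cobounded y).mono hll
    have hi' := (isBigO_inv_sub_cobounded (y - Complex.I)).mono hll
    have h1 := hFO.mul (hx'.mul hy')
    have h2 := (hy'.mul hi').const_mul_left (c * Complex.I)
    simp only [one_mul] at h1
    refine (h1.sub h2).congr' ?_ EventuallyEq.rfl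
    filter_upwards [hll (Bornology.eventually_ne_cobounded (x : ℂ)),
      hll (Bornology.eventually_ne_cobounded (y : ℂ))] with z hzx hzy
    rw [hform z hzx hzy, div_eq_mul_inv, div_eq_mul_inv, mul_inv, mul_inv, sub_add]
    ring
  obtain ⟨K, hK⟩ := hO.bound
  rw [eventually_inf_principal, hasBasis_cobounded_norm.eventually_iff] at hK
  obtain ⟨R₀, -, hR₀⟩ := hK
  have main := integrable_and_integral_eq_zero_of_upperHalfPlane (H := dslope N y) (K := K)
    (R₀ := R₀) (hHd.continuousOn.mono fun z (hz : 0 ≤ z.im) => by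
      simp only [hU, Set.mem_ofPred_eq]; linarith)
    (hHd.mono fun z (hz : 0 < z.im) => by simp only [hU, Set.mem_ofPred_eq]; linarith)
    (fun z hz hzR => by
      have := hR₀ hzR hz
      rwa [norm_mul, norm_inv, ← mul_inv, ← sq, ← div_eq_mul_inv] at this)
  have hae : (fun t : ℝ => dslope N y t) =ᵐ[volume] fun t : ℝ => F t / ((t - x) * (t - y)) -
      c * (Complex.I / ((t - y) * (t - y + Complex.I))) := by
    filter_upwards [Measure.ae_ne volume x, Measure.ae_ne volume y] with t htx hty
    exact hform t (by exact_mod_cast htx) (by exact_mod_cast hty)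
  exact ⟨main.1.congr hae, (integral_congr_ae hae).symm.trans main.2⟩

/-- For `f ∈ (ℰ_σ^∞)₊` and real `x ≠ y`, the function
`t ↦ (f(x) − f(t))/(x − t) · (e^{iσ(y−t)} − 1)/(y − t)` is Lebesgue integrable on `ℝ` and
`(f(x) − f(y))/(x − y) = (1/(2πi)) ∫_ℝ (f(x) − f(t))/(x − t) · (e^{iσ(y−t)} − 1)/(y − t) dt`. -/
theorem divided_difference_integral (σ : ℝ) (hσ : 0 < σ) (f : ℂ → ℂ)
    (hf : MemEInftyPlus σ f) (x y : ℝ) (hxy : x ≠ y) :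
    Integrable (fun t : ℝ =>
      ((f (x : ℂ) - f (t : ℂ)) / ((x : ℂ) - (t : ℂ))) *
        ((Complex.exp (Complex.I * ((σ * (y - t) : ℝ) : ℂ)) - 1) / ((y : ℂ) - (t : ℂ)))) ∧
    (f (x : ℂ) - f (y : ℂ)) / ((x : ℂ) - (y : ℂ))
      = (1 / (2 * (Real.pi : ℂ) * Complex.I)) *
          ∫ t : ℝ, ((f (x : ℂ) - f (t : ℂ)) / ((x : ℂ) - (t : ℂ))) *
            ((Complex.exp (Complex.I * ((σ * (y - t) : ℝ) : ℂ)) - 1) / ((y : ℂ) - (t : ℂ))) := by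
  obtain ⟨hfd, ⟨C₁, hC₁⟩, ⟨C₂, hC₂⟩⟩ := hf
  have hyx : (y : ℂ) - x ≠ 0 := sub_ne_zero.2 (by exact_mod_cast hxy.symm)
  have hxy' : (x : ℂ) - y ≠ 0 := sub_ne_zero.2 (by exact_mod_cast hxy)
  set c : ℂ := (f y - f x) / (y - x) with hc
  obtain ⟨hi₁, hz₁⟩ := integrable_and_integral_eq_zero_sub_polar (F := fun z => f z - f x)
    (C := C₁ + ‖f x‖) (by fun_prop)
    (fun z hz => (norm_sub_le _ _).trans (by gcongr; exact hC₁ z hz)) hxy (sub_self _)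
  have hbound : ∀ z : ℂ, 0 ≤ z.im →
      ‖(f x - f (-z)) * Complex.exp (Complex.I * (σ * (y + z)))‖ ≤ ‖f x‖ + C₂ := by
    intro z hz
    have h1 := hC₂ (-z) (by simpa using hz)
    have e1 : ‖Complex.exp (Complex.I * (σ * (y + z)))‖ ≤ 1 := by
      rw [Complex.norm_exp, Real.exp_le_one_iff]
      simpa using mul_nonneg hσ.le hz
    have e2 : ‖Complex.exp (Complex.I * (σ * y))‖ = 1 := by
      rw [Complex.norm_exp]
      simp
    have e3 : (f x - f (-z)) * Complex.exp (Complex.I * (σ * (y + z))) =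
        f x * Complex.exp (Complex.I * (σ * (y + z))) - Complex.exp (Complex.I * (σ * y)) *
          (Complex.exp (-(Complex.I * σ * (-z))) * f (-z)) := by
      rw [← mul_assoc (Complex.exp _) (Complex.exp _), ← Complex.exp_add, sub_mul]
      ring_nf
    rw [e3]
    refine (norm_sub_le _ _).trans (add_le_add ?_ ?_)
    · rw [norm_mul]
      exact mul_le_of_le_one_right (norm_nonneg _) e1
    · rw [norm_mul, e2, one_mul]
      exact h1
  obtain ⟨hi₂, hz₂⟩ := integrable_and_integral_eq_zero_sub_polar
    (F := fun z => (f x - f (-z)) * Complex.exp (Complex.I * (σ * (y + z))))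
    (by fun_prop) hbound (x := -x) (y := -y) (by simpa using hxy) (by simp)
  have hi₂' := hi₂.comp_neg
  rw [← integral_neg_eq_self] at hz₂
  have hi₃ : Integrable (fun t : ℝ => 2 * Complex.I * c * (((1 + (t - y) ^ 2)⁻¹ : ℝ) : ℂ)) :=
    ((integrable_inv_one_add_sq.comp_sub_right y).ofReal).const_mul _
  have hz₃ : ∫ t : ℝ, 2 * Complex.I * c * (((1 + (t - y) ^ 2)⁻¹ : ℝ) : ℂ) =
      2 * Complex.I * c * Real.pi := by
    rw [integral_const_mul, integral_complex_ofReal,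
      integral_sub_right_eq_self (fun t : ℝ => (1 + t ^ 2)⁻¹), integral_univ_inv_one_add_sq]
  have hsum := (hi₁.add hi₂').add hi₃
  have hisum := integral_add (hi₁.add hi₂') hi₃
  have hisum' := integral_add hi₁ hi₂'
  simp only [Pi.add_apply] at hsum hisum hisum'
  rw [hisum', hz₁, hz₂, hz₃, add_zero, zero_add] at hisum
  have hae : (fun t : ℝ => ((f t - f x) / ((t - x) * (t - y)) -
      (f y - f x) / (y - x) * (Complex.I / ((t - y) * (t - y + Complex.I))) +
      ((f x - f (-((-t : ℝ) : ℂ))) * Complex.exp (Complex.I * (σ * (y + ((-t : ℝ) : ℂ)))) /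
        ((((-t : ℝ) : ℂ) - ((-x : ℝ) : ℂ)) * (((-t : ℝ) : ℂ) - ((-y : ℝ) : ℂ))) -
      (f x - f (-((-y : ℝ) : ℂ))) * Complex.exp (Complex.I * (σ * (y + ((-y : ℝ) : ℂ)))) /
        (((-y : ℝ) : ℂ) - ((-x : ℝ) : ℂ)) * (Complex.I / ((((-t : ℝ) : ℂ) - ((-y : ℝ) : ℂ)) *
          (((-t : ℝ) : ℂ) - ((-y : ℝ) : ℂ) + Complex.I))))) +
      2 * Complex.I * c * (((1 + (t - y) ^ 2)⁻¹ : ℝ) : ℂ)) =ᵐ[volume]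
      fun t : ℝ => ((f x - f t) / (x - t)) *
        ((Complex.exp (Complex.I * ((σ * (y - t) : ℝ) : ℂ)) - 1) / (y - t)) := by
    filter_upwards [Measure.ae_ne volume x, Measure.ae_ne volume y] with t htx hty
    have htx' : (t : ℂ) - x ≠ 0 := sub_ne_zero.2 (by exact_mod_cast htx)
    have hty' : (t : ℂ) - y ≠ 0 := sub_ne_zero.2 (by exact_mod_cast hty)
    have hp : (t : ℂ) - y + Complex.I ≠ 0 := fun h => by simpa using congrArg Complex.im h
    have hm : (t : ℂ) - y - Complex.I ≠ 0 := fun h => by simpa using congrArg Complex.im h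
    have hfac : (1 : ℂ) + (t - y) ^ 2 = (t - y + Complex.I) * (t - y - Complex.I) := by
      linear_combination Complex.I_sq
    have hpolar : c * (Complex.I / ((t - y) * (t - y + Complex.I))) +
        c * (Complex.I / ((t - y) * (t - y - Complex.I))) =
        2 * Complex.I * c * (1 + ((t : ℂ) - y) ^ 2)⁻¹ := by
      rw [hfac]
      field_simp
      ring
    have e1 : (-(t : ℂ) - -x) * (-t - -y) = (t - x) * (t - y) := by ring
    have e2 : (-(t : ℂ) - -y) * (-t - -y + Complex.I) = (t - y) * (t - y - Complex.I) := by ring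
    have e3 : (f x - f y) / (-(y : ℂ) - -x) = c := by
      rw [hc, ← neg_sub (f y), ← neg_sub' (y : ℂ), neg_div_neg_eq]
    push_cast
    simp only [neg_neg, ← sub_eq_add_neg (y : ℂ), sub_self, mul_zero, Complex.exp_zero, mul_one]
    rw [e1, e2, e3, ← hc, ← hpolar, div_mul_div_comm (f x - f t),
      show ((x : ℂ) - t) * (y - t) = (t - x) * (t - y) by ring]
    ring
  refine ⟨hsum.congr hae, ?_⟩
  rw [← integral_congr_ae hae, hisum, hc]
  have hpi : (Real.pi : ℂ) ≠ 0 := by exact_mod_cast Real.pi_ne_zero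
  rw [← neg_sub (f y), ← neg_sub (y : ℂ), neg_div_neg_eq]
  field_simp
end

section
/- Let σ > 0, f ∈ (ℰ_σ^∞)_+, and x ∈ ℝ with σx ∉ 2πℤ. Then ∑_{n∈ℤ} |f(x) − f(2πn/σ)|²/(σx − 2πn)² = (1/(2πσ)) ∫_ℝ |f(x) − f(t)|²/(x − t)² dt, and both sides are finite. -/
open MeasureTheory

open Filter Topology ComplexConjugate

lemma integrable_of_norm_mul_one_add_sq_le {E : Type*} [NormedAddCommGroup E] {F : ℝ → E}
    (hF : Continuous F) {K : ℝ} (hK : ∀ t, ‖F t‖ * (1 + |t|) ^ 2 ≤ K) : Integrable F := by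
  refine (integrable_inv_one_add_sq.const_mul K).mono' hF.aestronglyMeasurable
    (Eventually.of_forall fun t => ?_)
  rw [← div_eq_mul_inv, le_div_iff₀ (by positivity)]
  refine le_trans ?_ (hK t)
  gcongr
  nlinarith [abs_nonneg t, sq_abs t]

/-- An entire function that is `O((1 + ‖z‖)⁻²)` on the closed upper half-plane has vanishing
integral along the real line. -/
lemma integral_real_eq_zero_of_upperHalfPlane_decay {F : ℂ → ℂ} (hF : Differentiable ℂ F) {K : ℝ}
    (hK : ∀ z : ℂ, 0 ≤ z.im → ‖F z‖ * (1 + ‖z‖) ^ 2 ≤ K) : ∫ t : ℝ, F t = 0 := by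
  have hint : Integrable fun t : ℝ => F t :=
    integrable_of_norm_mul_one_add_sq_le (hF.continuous.comp Complex.continuous_ofReal)
      (fun t => by simpa using hK t (by simp))
  have hlim := intervalIntegral_tendsto_integral hint tendsto_neg_atTop_atBot tendsto_id
  have hbound : ∀ T : ℝ, 0 < T → ∀ z : ℂ, 0 ≤ z.im → T ≤ ‖z‖ → ‖F z‖ ≤ K / T ^ 2 := by
    intro T hT z hz hTz
    rw [le_div_iff₀ (by positivity)]
    refine le_trans ?_ (hK z hz)
    gcongr
    linarith
  refine tendsto_nhds_unique hlim (squeeze_zero_norm' (a := fun T : ℝ => 4 * K * T⁻¹) ?_ ?_)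
  · filter_upwards [eventually_gt_atTop 0] with T hT
    have hrect := Complex.integral_boundary_rect_eq_zero_of_differentiableOn F (-T : ℝ) ⟨T, T⟩
      hF.differentiableOn
    simp only [Complex.ofReal_re, Complex.ofReal_im, Complex.ofReal_zero, zero_mul, add_zero]
      at hrect
    have htop : ‖∫ x : ℝ in (-T)..T, F (x + T * Complex.I)‖ ≤ K / T ^ 2 * |T - -T| := by
      refine intervalIntegral.norm_integral_le_of_norm_le_const fun s _ =>
        hbound T hT _ (by simpa using hT.le) ?_
      simpa [abs_of_pos hT] using Complex.abs_im_le_norm (s + T * Complex.I)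
    have hside : ∀ c : ℝ, |c| = T →
        ‖∫ y : ℝ in (0 : ℝ)..T, F (c + y * Complex.I)‖ ≤ K / T ^ 2 * |T - 0| := by
      intro c hc
      refine intervalIntegral.norm_integral_le_of_norm_le_const fun s hs =>
        hbound T hT _ ?_ ?_
      · rw [Set.uIoc_of_le hT.le] at hs
        simpa using hs.1.le
      · simpa [hc] using Complex.abs_re_le_norm (c + s * Complex.I)
    have hr := hside T (abs_of_pos hT)
    have hl := hside (-T) (by rw [abs_neg, abs_of_pos hT])
    rw [sub_neg_eq_add, abs_of_pos (by linarith : 0 < T + T)] at htop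
    rw [sub_zero, abs_of_pos hT] at hr hl
    have heq : (∫ x : ℝ in (-T)..T, F x) = (∫ x : ℝ in (-T)..T, F (x + T * Complex.I))
        - Complex.I * (∫ y : ℝ in (0 : ℝ)..T, F ((T : ℝ) + y * Complex.I))
        + Complex.I * (∫ y : ℝ in (0 : ℝ)..T, F ((-T : ℝ) + y * Complex.I)) := by
      simp only [smul_eq_mul] at hrect
      linear_combination hrect
    have hsum : K / T ^ 2 * (T + T) + K / T ^ 2 * T + K / T ^ 2 * T = 4 * K * T⁻¹ := by
      field_simp
      ring
    simp only [id]
    rw [heq, ← hsum]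
    refine (norm_add_le _ _).trans (add_le_add ((norm_sub_le _ _).trans (add_le_add htop ?_)) ?_)
    · simpa using hr
    · simpa using hl
  · simpa using tendsto_inv_atTop_zero.const_mul (4 * K)

/-- The Fourier transform of an entire function of exponential type `2π` with quadratic decay
vanishes outside `(-1, 1)`. -/
lemma fourier_eq_zero_of_exponential_type {H : ℂ → ℂ} (hH : Differentiable ℂ H) {K : ℝ}
    (hK : ∀ z : ℂ, ‖H z‖ * (1 + ‖z‖) ^ 2 ≤ K * Real.exp (2 * Real.pi * |z.im|))
    {ξ : ℝ} (hξ : 1 ≤ |ξ|) : FourierTransform.fourier (fun t : ℝ => H t) ξ = 0 := by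
  have hK0 : 0 ≤ K := by
    have := hK 0
    simp only [norm_zero, add_zero, one_pow, mul_one, Complex.zero_im, abs_zero, mul_zero,
      Real.exp_zero] at this
    exact (norm_nonneg _).trans this
  have key : ∀ (L : ℂ → ℂ) (s : ℝ), Differentiable ℂ L → 1 ≤ s →
      (∀ z : ℂ, ‖L z‖ * (1 + ‖z‖) ^ 2 ≤ K * Real.exp (2 * Real.pi * |z.im|)) →
      ∫ t : ℝ, Complex.exp (2 * Real.pi * t * s * Complex.I) * L t = 0 := by
    intro L s hL hs hLK
    refine integral_real_eq_zero_of_upperHalfPlane_decay (K := K)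
      (F := fun z => Complex.exp (2 * Real.pi * z * s * Complex.I) * L z) (by fun_prop) ?_
    intro z hz
    have hexp : ‖Complex.exp (2 * Real.pi * z * s * Complex.I)‖
        = Real.exp (-(2 * Real.pi * s * z.im)) := by
      rw [Complex.norm_exp]
      congr 1
      simp
      ring
    rw [norm_mul, hexp, mul_assoc]
    have h1 := hLK z
    rw [abs_of_nonneg hz] at h1
    calc _ ≤ Real.exp (-(2 * Real.pi * s * z.im)) * (K * Real.exp (2 * Real.pi * z.im)) := by
          gcongr
      _ = K * Real.exp (-(2 * Real.pi * (s - 1) * z.im)) := by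
          rw [mul_left_comm, ← Real.exp_add]
          ring_nf
      _ ≤ K * 1 := by
          gcongr
          rw [Real.exp_le_one_iff, neg_nonpos]
          have := Real.pi_pos
          have : 0 ≤ s - 1 := by linarith
          positivity
      _ = K := mul_one K
  rw [Real.fourier_real_eq_integral_exp_smul]
  rcases le_abs'.1 hξ with h | h
  · rw [← key H (-ξ) hH (by linarith) hK]
    congr 1 with t
    rw [smul_eq_mul]
    congr 2
    push_cast
    ring
  · rw [← integral_neg_eq_self, ← key (fun z => H (-z)) ξ (by fun_prop) h
      (fun z => by simpa using hK (-z))]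
    congr 1 with t
    rw [smul_eq_mul]
    congr 2 <;> push_cast <;> ring

/-- For an entire function of exponential type `2π` with quadratic decay, the sum over the integers
equals the integral over the real line. -/
lemma hasSum_int_eq_integral_of_exponential_type {H : ℂ → ℂ} (hH : Differentiable ℂ H) {K : ℝ}
    (hK : ∀ z : ℂ, ‖H z‖ * (1 + ‖z‖) ^ 2 ≤ K * Real.exp (2 * Real.pi * |z.im|)) :
    HasSum (fun n : ℤ => H (n : ℝ)) (∫ t : ℝ, H t) := by
  have hcont : Continuous fun t : ℝ => H t := hH.continuous.comp Complex.continuous_ofReal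
  have hO : (fun t : ℝ => H t) =O[cocompact ℝ] fun t : ℝ => |t| ^ (-2 : ℝ) := by
    refine Asymptotics.IsBigO.of_bound K ?_
    filter_upwards [(isCompact_singleton (x := (0 : ℝ))).compl_mem_cocompact] with t ht
    have ht0 : 0 < |t| := abs_pos.2 ht
    have h1 := hK t
    simp only [Complex.norm_real, Real.norm_eq_abs, Complex.ofReal_im, abs_zero, mul_zero,
      Real.exp_zero, mul_one] at h1
    rw [Real.rpow_neg ht0.le, norm_inv, ← div_eq_mul_inv, Real.rpow_two, Real.norm_eq_abs,
      abs_of_pos (by positivity), le_div_iff₀ (by positivity)]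
    refine le_trans ?_ h1
    gcongr
    linarith
  have hFO : (FourierTransform.fourier fun t : ℝ => H t) =O[cocompact ℝ]
      fun t : ℝ => |t| ^ (-2 : ℝ) := by
    refine Asymptotics.IsBigO.of_bound 0 ?_
    filter_upwards [(isCompact_Icc (a := (-1 : ℝ)) (b := 1)).compl_mem_cocompact] with t ht
    rw [fourier_eq_zero_of_exponential_type hH hK]
    · simp
    · by_contra! h
      exact ht ⟨(abs_lt.1 h).1.le, (abs_lt.1 h).2.le⟩
  have hsum : Summable fun n : ℤ => H (n : ℝ) :=
    summable_of_isBigO (Real.summable_abs_int_rpow one_lt_two)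
      (hO.comp_tendsto Int.tendsto_coe_cofinite)
  have hP := Real.tsum_eq_tsum_fourier_of_rpow_decay hcont one_lt_two hO hFO 0
  rw [tsum_eq_single (f := fun n : ℤ =>
    FourierTransform.fourier (fun t : ℝ => H t) n * fourier n ((0 : ℝ) : UnitAddCircle)) 0] at hP
  · have : ∫ t : ℝ, H t = ∑' n : ℤ, H (n : ℝ) := by
      simpa [Real.fourier_real_eq_integral_exp_smul] using hP.symm
    rw [this]
    exact hsum.hasSum
  · intro n hn
    rw [fourier_eq_zero_of_exponential_type hH hK, zero_mul]
    rw [← Int.cast_abs]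
    exact_mod_cast Int.one_le_abs hn

/-- Plancherel–Pólya identity: an entire `G` that is `O((1 + ‖z‖)⁻¹)` on the upper half-plane and
`O(e^{2π|Im z|}(1 + ‖z‖)⁻¹)` on the lower one has equal `ℓ²(ℤ)` and `L²(ℝ)` norms. -/
lemma integrable_and_hasSum_norm_sq {G : ℂ → ℂ} (hG : Differentiable ℂ G) {K K' : ℝ}
    (hK : ∀ z : ℂ, 0 ≤ z.im → (1 + ‖z‖) * ‖G z‖ ≤ K)
    (hK' : ∀ z : ℂ, z.im ≤ 0 →
      (1 + ‖z‖) * ‖Complex.exp (-(Complex.I * (2 * Real.pi : ℝ) * z)) * G z‖ ≤ K') :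
    (Integrable fun t : ℝ => ‖G t‖ ^ 2) ∧
      HasSum (fun n : ℤ => ‖G (n : ℝ)‖ ^ 2) (∫ t : ℝ, ‖G t‖ ^ 2) := by
  have hK0 : 0 ≤ K := le_trans (by positivity) (hK 0 le_rfl)
  have hlower : ∀ z : ℂ, z.im ≤ 0 →
      (1 + ‖z‖) * ‖G z‖ ≤ K' * Real.exp (2 * Real.pi * |z.im|) := by
    intro z hz
    have h := hK' z hz
    have hexp : ‖Complex.exp (-(Complex.I * (2 * Real.pi : ℝ) * z))‖
        = (Real.exp (2 * Real.pi * |z.im|))⁻¹ := by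
      rw [Complex.norm_exp, ← Real.exp_neg, abs_of_nonpos hz]
      congr 1
      simp
    rw [norm_mul, hexp] at h
    rw [← div_le_iff₀ (Real.exp_pos _)]
    refine le_trans (le_of_eq ?_) h
    ring
  set H : ℂ → ℂ := fun z => G z * conj (G (conj z)) with hH_def
  have hH : Differentiable ℂ H := hG.mul fun z => differentiableAt_conj_conj_iff.2 (hG (conj z))
  have hreal : ∀ t : ℝ, H t = ((‖G t‖ ^ 2 : ℝ) : ℂ) := by
    intro t
    simp only [hH_def, Complex.conj_ofReal, Complex.mul_conj, Complex.normSq_eq_norm_sq]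
  have hbound : ∀ z : ℂ, ‖H z‖ * (1 + ‖z‖) ^ 2 ≤ K * K' * Real.exp (2 * Real.pi * |z.im|) := by
    intro z
    have hsplit : ‖H z‖ * (1 + ‖z‖) ^ 2
        = ((1 + ‖z‖) * ‖G z‖) * ((1 + ‖conj z‖) * ‖G (conj z)‖) := by
      simp only [hH_def, norm_mul, RCLike.norm_conj]
      ring
    rw [hsplit, mul_assoc K]
    rcases le_total 0 z.im with hz | hz
    · have h1 := hK z hz
      have h2 := hlower (conj z) (by simpa using hz)
      rw [Complex.conj_im, abs_neg] at h2
      exact mul_le_mul h1 h2 (by positivity) hK0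
    · have h1 := hK (conj z) (by simpa using hz)
      have h2 := hlower z hz
      rw [mul_comm ((1 + ‖z‖) * ‖G z‖)]
      exact mul_le_mul h1 h2 (by positivity) hK0
  have hsum := hasSum_int_eq_integral_of_exponential_type hH hbound
  simp only [hreal, integral_complex_ofReal] at hsum
  refine ⟨?_, Complex.hasSum_ofReal.1 hsum⟩
  refine integrable_of_norm_mul_one_add_sq_le (K := K * K')
    ((hG.continuous.comp Complex.continuous_ofReal).norm.pow 2) fun t => ?_
  have h := hbound t
  rw [hreal, Complex.norm_real] at h
  simpa using h

lemma exists_one_add_norm_mul_le {g : ℂ → ℂ} (hg : Continuous g) (c : ℂ) (S : Set ℂ) {M : ℝ}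
    (hM : ∀ z ∈ S, ‖z - c‖ * ‖g z‖ ≤ M) : ∃ K : ℝ, ∀ z ∈ S, (1 + ‖z‖) * ‖g z‖ ≤ K := by
  obtain ⟨B, hB⟩ := (isCompact_closedBall c 1).exists_bound_of_continuousOn hg.continuousOn
  refine ⟨(2 + ‖c‖) * max B M, fun z hz => ?_⟩
  have htri : ‖z‖ ≤ ‖z - c‖ + ‖c‖ := by simpa using norm_add_le (z - c) c
  rcases le_total ‖z - c‖ 1 with h | h
  · have h1 := hB z (by simpa [dist_eq_norm] using h)
    exact mul_le_mul (by linarith) (h1.trans (le_max_left _ _)) (norm_nonneg _) (by positivity)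
  · calc (1 + ‖z‖) * ‖g z‖ ≤ ((2 + ‖c‖) * ‖z - c‖) * ‖g z‖ := by
          gcongr
          nlinarith [norm_nonneg c]
      _ = (2 + ‖c‖) * (‖z - c‖ * ‖g z‖) := mul_assoc _ _ _
      _ ≤ (2 + ‖c‖) * max B M := by
          gcongr
          exact (hM z hz).trans (le_max_right _ _)

lemma norm_sub_mul_norm_dslope (f : ℂ → ℂ) (c z : ℂ) :
    ‖z - c‖ * ‖dslope f c z‖ = ‖f z - f c‖ := by
  rw [← norm_mul, ← smul_eq_mul, sub_smul_dslope]

lemma norm_dslope_sq_eq_div (f : ℂ → ℂ) {c t : ℝ} (h : t ≠ c) :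
    ‖dslope f c t‖ ^ 2 = ‖f c - f t‖ ^ 2 / (c - t) ^ 2 := by
  have hct : (c - t) ^ 2 ≠ 0 := pow_ne_zero 2 (sub_ne_zero.2 h.symm)
  rw [eq_div_iff hct, norm_sub_rev, ← norm_sub_mul_norm_dslope, mul_pow, ← Complex.ofReal_sub,
    Complex.norm_real, Real.norm_eq_abs, sq_abs]
  ring

/-- The difference quotient of a member of `(ℰ_{2π}^∞)₊` has equal `ℓ²(ℤ)` and `L²(ℝ)` norms. -/
lemma MemEInftyPlus.integrable_and_hasSum_dslope {f : ℂ → ℂ} (hf : MemEInftyPlus (2 * Real.pi) f)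
    (c : ℝ) :
    (Integrable fun t : ℝ => ‖dslope f c t‖ ^ 2) ∧
      HasSum (fun n : ℤ => ‖dslope f c (n : ℝ)‖ ^ 2) (∫ t : ℝ, ‖dslope f c t‖ ^ 2) := by
  obtain ⟨hd, ⟨C, hC⟩, ⟨C', hC'⟩⟩ := hf
  have hG : Differentiable ℂ (dslope f c) := by
    rw [← differentiableOn_univ, Complex.differentiableOn_dslope univ_mem]
    exact hd.differentiableOn
  obtain ⟨K, hK⟩ := exists_one_add_norm_mul_le hG.continuous c {z | 0 ≤ z.im} (M := C + ‖f c‖)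
    fun z hz => by
      rw [norm_sub_mul_norm_dslope]
      exact (norm_sub_le _ _).trans (by gcongr; exact hC z hz)
  obtain ⟨K', hK'⟩ := exists_one_add_norm_mul_le
    (g := fun z => Complex.exp (-(Complex.I * (2 * Real.pi : ℝ) * z)) * dslope f c z)
    (by have := hG.continuous; fun_prop) c {z | z.im ≤ 0} (M := C' + ‖f c‖)
    fun z hz => by
      rw [norm_mul, mul_left_comm, norm_sub_mul_norm_dslope, ← norm_mul, mul_sub]
      refine (norm_sub_le _ _).trans (add_le_add (hC' z hz) ?_)
      rw [norm_mul]
      refine mul_le_of_le_one_left (norm_nonneg _) ?_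
      rw [Complex.norm_exp, Real.exp_le_one_iff]
      simpa using mul_nonpos_of_nonneg_of_nonpos Real.two_pi_pos.le hz
  exact integrable_and_hasSum_norm_sq hG hK hK'

lemma MemEInftyPlus.comp_const_mul {σ a : ℝ} {f : ℂ → ℂ} (hf : MemEInftyPlus σ f) (ha : 0 ≤ a) :
    MemEInftyPlus (σ * a) fun z => f (a * z) := by
  obtain ⟨hd, ⟨C, hC⟩, ⟨C', hC'⟩⟩ := hf
  refine ⟨by fun_prop, ⟨C, fun z hz => hC _ ?_⟩, ⟨C', fun z hz => ?_⟩⟩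
  · simpa using mul_nonneg ha hz
  · have h := hC' (a * z) (by simpa using mul_nonpos_of_nonneg_of_nonpos ha hz)
    rwa [← mul_assoc, mul_assoc Complex.I, ← Complex.ofReal_mul] at h

/-- For `f ∈ (ℰ_σ^∞)₊` and `x ∈ ℝ` with `σx ∉ 2πℤ`,
`∑_{n∈ℤ} |f(x) − f(2πn/σ)|²/(σx − 2πn)² = (1/(2πσ)) ∫_ℝ |f(x) − f(t)|²/(x − t)² dt`,
and both sides are finite. -/
theorem ell2_sum_eq_integral (σ : ℝ) (hσ : 0 < σ) (f : ℂ → ℂ)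
    (hf : MemEInftyPlus σ f) (x : ℝ) (hx : ∀ n : ℤ, σ * x ≠ 2 * Real.pi * n) :
    Integrable (fun t : ℝ => ‖f (x : ℂ) - f (t : ℂ)‖ ^ 2 / (x - t) ^ 2) ∧
    HasSum (fun n : ℤ =>
        ‖f (x : ℂ) - f ((2 * Real.pi * n / σ : ℝ) : ℂ)‖ ^ 2 / (σ * x - 2 * Real.pi * n) ^ 2)
      ((1 / (2 * Real.pi * σ)) * ∫ t : ℝ, ‖f (x : ℂ) - f (t : ℂ)‖ ^ 2 / (x - t) ^ 2) := by
  set a : ℝ := 2 * Real.pi / σ with ha_def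
  have ha : 0 < a := by positivity
  have hσa : σ * a = 2 * Real.pi := by rw [ha_def]; field_simp
  set c : ℝ := x / a with hc_def
  have hac : a * c = x := by rw [hc_def]; field_simp
  have hf' := hf.comp_const_mul ha.le
  rw [hσa] at hf'
  obtain ⟨hint, hsum⟩ := hf'.integrable_and_hasSum_dslope c
  have hquot : ∀ s : ℝ, s ≠ c →
      ‖dslope (fun z : ℂ => f (a * z)) c s‖ ^ 2
        = a ^ 2 * (‖f (x : ℂ) - f ((a * s : ℝ) : ℂ)‖ ^ 2 / (x - a * s) ^ 2) := by
    intro s hs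
    have hcs : c - s ≠ 0 := sub_ne_zero.2 hs.symm
    rw [norm_dslope_sq_eq_div _ hs]
    simp only [← Complex.ofReal_mul]
    rw [hac, show x - a * s = a * (c - s) by rw [← hac]; ring]
    field_simp
  set Q : ℝ → ℝ := fun t => ‖f (x : ℂ) - f (t : ℂ)‖ ^ 2 / (x - t) ^ 2
  have hae : (fun s : ℝ => ‖dslope (fun z : ℂ => f (a * z)) c s‖ ^ 2)
      =ᵐ[volume] fun s => a ^ 2 * Q (a * s) := by
    filter_upwards [compl_mem_ae_iff.2 (measure_singleton c)] with s hs using hquot s hs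
  refine ⟨?_, ?_⟩
  · have h1 := (hint.congr hae).const_mul (a ^ 2)⁻¹
    refine (integrable_comp_mul_left_iff Q ha.ne').1 (h1.congr (Eventually.of_forall fun s => ?_))
    exact inv_mul_cancel_left₀ (by positivity) _
  · rw [integral_congr_ae hae, integral_const_mul, Measure.integral_comp_mul_left,
      abs_of_pos (inv_pos.2 ha), smul_eq_mul] at hsum
    have h2 := hsum.mul_left (1 / (2 * Real.pi) ^ 2)
    have hval : 1 / (2 * Real.pi) ^ 2 * (a ^ 2 * (a⁻¹ * ∫ t, Q t))
        = 1 / (2 * Real.pi * σ) * ∫ t, Q t := by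
      rw [ha_def]
      field_simp
    rw [hval] at h2
    refine h2.congr_fun fun n => ?_
    have hn : (n : ℝ) ≠ c := by
      intro h
      apply hx n
      rw [← hσa, mul_assoc, h, hac]
    rw [hquot _ hn]
    have han : a * (n : ℝ) = 2 * Real.pi * n / σ := by rw [ha_def]; ring
    have hden : σ * x - 2 * Real.pi * n = σ * (x - a * n) := by rw [← hσa]; ring
    have hxn : x - a * n ≠ 0 := by
      rw [← hac, ← mul_sub]
      exact mul_ne_zero ha.ne' (sub_ne_zero.2 hn.symm)
    rw [hden, ← han, ← hσa]
    field_simp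
end
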